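/- arXiv:1208.0434 — 2 statements merged into one kernel-verified Lean document; each statement's English description precedes it below -/
import Mathlib

section
/- Quadruple comparison (nonnegative curvature): for every quadruple of metric measure spaces (X₀,d₀,m₀), (X₁,d₁,m₁), (X₂,d₂,m₂), (X₃,d₃,m₃) of finite L²-size, ∑_{i=1}^{3} DD(X₀, X_i)² ≥ (1/3) · ∑_{1 ≤ i < j ≤ 3} DD(X_i, X_j)², where DD denotes the L²-distortion distance. -/
open MeasureTheory ENNReal

/-- The set of couplings of two measures: measures on the product whose marginals
are the two given measures. -/
def Cpl {α β : Type*} [MeasurableSpace α] [MeasurableSpace β]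
    (m₀ : Measure α) (m₁ : Measure β) : Set (Measure (α × β)) :=
  {μ | μ.map Prod.fst = m₀ ∧ μ.map Prod.snd = m₁}

/-- The `L²`-distortion of a coupling `μ` of two gauged (e.g. metric) measure
spaces with gauges `f₀` and `f₁`:
`(∬ |f₀(x₀,y₀) − f₁(x₁,y₁)|² dμ dμ)^(1/2)`. -/
noncomputable def distortion2 {α β : Type*} [MeasurableSpace α] [MeasurableSpace β]
    (f₀ : α → α → ℝ) (f₁ : β → β → ℝ) (μ : Measure (α × β)) : ℝ≥0∞ :=
  (∫⁻ z, ∫⁻ w, ENNReal.ofReal ((f₀ z.1 w.1 - f₁ z.2 w.2) ^ 2) ∂μ ∂μ) ^ (1 / 2 : ℝ)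

/-- The `L²`-distortion distance between two gauged (e.g. metric) measure spaces:
the infimum of the `L²`-distortion over all couplings. -/
noncomputable def DD2 {α β : Type*} [MeasurableSpace α] [MeasurableSpace β]
    (f₀ : α → α → ℝ) (f₁ : β → β → ℝ) (m₀ : Measure α) (m₁ : Measure β) : ℝ≥0∞ :=
  ⨅ μ ∈ Cpl m₀ m₁, distortion2 f₀ f₁ μ

open ProbabilityTheory

section

variable {α β γ δ Ω : Type*} [MeasurableSpace α] [MeasurableSpace β] [MeasurableSpace γ]
  [MeasurableSpace δ] [MeasurableSpace Ω]

theorem isProbabilityMeasure_of_mem_Cpl {m₀ : Measure α} {m₁ : Measure β}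
    [IsProbabilityMeasure m₀] {μ : Measure (α × β)} (hμ : μ ∈ Cpl m₀ m₁) :
    IsProbabilityMeasure μ := by
  have : IsProbabilityMeasure (μ.map Prod.fst) := by rw [hμ.1]; infer_instance
  exact Measure.isProbabilityMeasure_of_map Prod.fst

/-- The disintegration of a coupling over its first marginal. -/
theorem exists_kernel_of_mem_Cpl [StandardBorelSpace β] {m₀ : Measure α} {m₁ : Measure β}
    [IsProbabilityMeasure m₀] [IsProbabilityMeasure m₁] {μ : Measure (α × β)}
    (hμ : μ ∈ Cpl m₀ m₁) :
    ∃ κ : Kernel α β, IsMarkovKernel κ ∧ m₀ ⊗ₘ κ = μ := by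
  have := isProbabilityMeasure_of_mem_Cpl hμ
  have : Nonempty β := nonempty_of_isProbabilityMeasure m₁
  refine ⟨μ.condKernel, inferInstance, ?_⟩
  have h : μ.fst = m₀ := hμ.1
  conv_lhs => rw [← h]
  exact μ.disintegrate μ.condKernel

/-- Gluing of three couplings along a common first marginal. -/
theorem exists_gluing [StandardBorelSpace β] [StandardBorelSpace γ] [StandardBorelSpace δ]
    {m₀ : Measure α} {m₁ : Measure β} {m₂ : Measure γ} {m₃ : Measure δ}
    [IsProbabilityMeasure m₀] [IsProbabilityMeasure m₁] [IsProbabilityMeasure m₂]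
    [IsProbabilityMeasure m₃]
    {μ₁ : Measure (α × β)} {μ₂ : Measure (α × γ)} {μ₃ : Measure (α × δ)}
    (h₁ : μ₁ ∈ Cpl m₀ m₁) (h₂ : μ₂ ∈ Cpl m₀ m₂) (h₃ : μ₃ ∈ Cpl m₀ m₃) :
    ∃ P : Measure (α × β × γ × δ), IsProbabilityMeasure P ∧
      P.map (fun z => (z.1, z.2.1)) = μ₁ ∧ P.map (fun z => (z.1, z.2.2.1)) = μ₂ ∧
      P.map (fun z => (z.1, z.2.2.2)) = μ₃ := by
  obtain ⟨κ₁, _, rfl⟩ := exists_kernel_of_mem_Cpl h₁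
  obtain ⟨κ₂, _, rfl⟩ := exists_kernel_of_mem_Cpl h₂
  obtain ⟨κ₃, _, rfl⟩ := exists_kernel_of_mem_Cpl h₃
  have e₁ : (κ₁ ×ₖ (κ₂ ×ₖ κ₃)).map (fun z => z.1) = κ₁ := by
    rw [← Kernel.fst_eq, Kernel.fst_prod]
  have e₀ : (κ₁ ×ₖ (κ₂ ×ₖ κ₃)).map (fun z => z.2) = κ₂ ×ₖ κ₃ := by
    rw [← Kernel.snd_eq, Kernel.snd_prod]
  have e₂ : (κ₁ ×ₖ (κ₂ ×ₖ κ₃)).map (fun z => z.2.1) = κ₂ := by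
    change (κ₁ ×ₖ (κ₂ ×ₖ κ₃)).map (Prod.fst ∘ fun z => z.2) = κ₂
    rw [Kernel.map_comp_right _ (by fun_prop) (by fun_prop), e₀, ← Kernel.fst_eq,
      Kernel.fst_prod]
  have e₃ : (κ₁ ×ₖ (κ₂ ×ₖ κ₃)).map (fun z => z.2.2) = κ₃ := by
    change (κ₁ ×ₖ (κ₂ ×ₖ κ₃)).map (Prod.snd ∘ fun z => z.2) = κ₃
    rw [Kernel.map_comp_right _ (by fun_prop) (by fun_prop), e₀, ← Kernel.snd_eq,
      Kernel.snd_prod]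
  refine ⟨m₀ ⊗ₘ (κ₁ ×ₖ (κ₂ ×ₖ κ₃)), inferInstance, ?_, ?_, ?_⟩
  · conv_rhs => rw [← e₁, Measure.compProd_map (by fun_prop)]
    rfl
  · conv_rhs => rw [← e₂, Measure.compProd_map (by fun_prop)]
    rfl
  · conv_rhs => rw [← e₃, Measure.compProd_map (by fun_prop)]
    rfl

theorem map_mem_Cpl {P : Measure Ω} {f : Ω → α} {g : Ω → β}
    (hf : Measurable f) (hg : Measurable g) :
    P.map (fun z => (f z, g z)) ∈ Cpl (P.map f) (P.map g) := by
  constructor <;> rw [Measure.map_map (by fun_prop) (by fun_prop)] <;> rfl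

theorem distortion2_sq_map {P : Measure Ω} [IsProbabilityMeasure P] {f : Ω → α} {g : Ω → β}
    (hf : Measurable f) (hg : Measurable g) {f₀ : α → α → ℝ} {f₁ : β → β → ℝ}
    (h₀ : Measurable (Function.uncurry f₀)) (h₁ : Measurable (Function.uncurry f₁)) :
    distortion2 f₀ f₁ (P.map (fun z => (f z, g z))) ^ 2 =
      ∫⁻ p, ENNReal.ofReal ((f₀ (f p.1) (f p.2) - f₁ (g p.1) (g p.2)) ^ 2) ∂(P.prod P) := by
  have hfg : Measurable fun z => (f z, g z) := by fun_prop
  have : IsProbabilityMeasure (P.map fun z => (f z, g z)) :=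
    Measure.isProbabilityMeasure_map hfg.aemeasurable
  have hF : Measurable fun p : (α × β) × (α × β) =>
      ENNReal.ofReal ((f₀ p.1.1 p.2.1 - f₁ p.1.2 p.2.2) ^ 2) := by
    have a : Measurable fun p : (α × β) × (α × β) => f₀ p.1.1 p.2.1 :=
      h₀.comp (g := Function.uncurry f₀) (f := fun p : (α × β) × (α × β) => (p.1.1, p.2.1))
        (by fun_prop)
    have b : Measurable fun p : (α × β) × (α × β) => f₁ p.1.2 p.2.2 :=
      h₁.comp (g := Function.uncurry f₁) (f := fun p : (α × β) × (α × β) => (p.1.2, p.2.2))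
        (by fun_prop)
    fun_prop
  rw [distortion2, ← ENNReal.rpow_natCast, ← ENNReal.rpow_mul]
  norm_num only [ENNReal.rpow_one]
  rw [← lintegral_prod (fun p : (α × β) × (α × β) =>
      ENNReal.ofReal ((f₀ p.1.1 p.2.1 - f₁ p.1.2 p.2.2) ^ 2)) hF.aemeasurable,
    Measure.map_prod_map _ _ hfg hfg, lintegral_map hF (by fun_prop)]
  rfl

theorem DD2_sq_le_lintegral {P : Measure Ω} [IsProbabilityMeasure P] {f : Ω → α} {g : Ω → β}
    (hf : Measurable f) (hg : Measurable g) {f₀ : α → α → ℝ} {f₁ : β → β → ℝ}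
    (h₀ : Measurable (Function.uncurry f₀)) (h₁ : Measurable (Function.uncurry f₁)) :
    DD2 f₀ f₁ (P.map f) (P.map g) ^ 2 ≤
      ∫⁻ p, ENNReal.ofReal ((f₀ (f p.1) (f p.2) - f₁ (g p.1) (g p.2)) ^ 2) ∂(P.prod P) := by
  rw [← distortion2_sq_map hf hg h₀ h₁]
  gcongr
  exact iInf₂_le _ (map_mem_Cpl hf hg)

theorem DD2_ne_top {m₀ : Measure α} {m₁ : Measure β}
    [IsProbabilityMeasure m₀] [IsProbabilityMeasure m₁] {f₀ : α → α → ℝ} {f₁ : β → β → ℝ}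
    (h₀ : Measurable (Function.uncurry f₀)) (h₁ : Measurable (Function.uncurry f₁))
    (hs₀ : (∫⁻ x, ∫⁻ y, ENNReal.ofReal (f₀ x y ^ 2) ∂m₀ ∂m₀) ≠ ⊤)
    (hs₁ : (∫⁻ x, ∫⁻ y, ENNReal.ofReal (f₁ x y ^ 2) ∂m₁ ∂m₁) ≠ ⊤) :
    DD2 f₀ f₁ m₀ m₁ ≠ ⊤ := by
  have key := DD2_sq_le_lintegral (P := m₀.prod m₁) measurable_fst measurable_snd h₀ h₁
  have e₀ : (m₀.prod m₁).map Prod.fst = m₀ := by simp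
  have e₁ : (m₀.prod m₁).map Prod.snd = m₁ := by simp
  rw [e₀, e₁] at key
  have hm₀ : Measurable fun p : α × α => ENNReal.ofReal (f₀ p.1 p.2 ^ 2) :=
    (h₀.pow_const 2).ennreal_ofReal
  have hm₁ : Measurable fun p : β × β => ENNReal.ofReal (f₁ p.1 p.2 ^ 2) :=
    (h₁.pow_const 2).ennreal_ofReal
  rw [← lintegral_prod (fun p : α × α => ENNReal.ofReal (f₀ p.1 p.2 ^ 2)) hm₀.aemeasurable,
    ← e₀, Measure.map_prod_map _ _ measurable_fst measurable_fst,
    lintegral_map hm₀ (by fun_prop)] at hs₀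
  rw [← lintegral_prod (fun p : β × β => ENNReal.ofReal (f₁ p.1 p.2 ^ 2)) hm₁.aemeasurable,
    ← e₁, Measure.map_prod_map _ _ measurable_snd measurable_snd,
    lintegral_map hm₁ (by fun_prop)] at hs₁
  have hbound : DD2 f₀ f₁ m₀ m₁ ^ 2 < ⊤ := by
    refine (key.trans (lintegral_mono fun p => ?_)).trans_lt (b :=
      ∫⁻ p, 2 * (ENNReal.ofReal (f₀ p.1.1 p.2.1 ^ 2) + ENNReal.ofReal (f₁ p.1.2 p.2.2 ^ 2))
        ∂((m₀.prod m₁).prod (m₀.prod m₁))) ?_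
    · rw [← ENNReal.ofReal_add (sq_nonneg _) (sq_nonneg _), ← ENNReal.ofReal_ofNat 2,
        ← ENNReal.ofReal_mul zero_le_two]
      exact ENNReal.ofReal_le_ofReal (by
        nlinarith [sq_nonneg (f₀ p.1.1 p.2.1 + f₁ p.1.2 p.2.2)])
    · rw [lintegral_const_mul' _ _ (by simp), lintegral_add_left
        (f := fun p : (α × β) × (α × β) => ENNReal.ofReal (f₀ p.1.1 p.2.1 ^ 2))
        (hm₀.comp (f := fun p : (α × β) × (α × β) => (p.1.1, p.2.1)) (by fun_prop))]
      exact ENNReal.mul_lt_top (by simp)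
        (ENNReal.add_lt_top.2 ⟨lt_top_iff_ne_top.2 hs₀, lt_top_iff_ne_top.2 hs₁⟩)
  intro h
  simp [h] at hbound

/-- Quadruple comparison with distortions of arbitrary couplings on the large side. -/
theorem sum_DD2_sq_le_distortion2 [StandardBorelSpace β] [StandardBorelSpace γ]
    [StandardBorelSpace δ]
    {m₀ : Measure α} {m₁ : Measure β} {m₂ : Measure γ} {m₃ : Measure δ}
    [IsProbabilityMeasure m₀] [IsProbabilityMeasure m₁] [IsProbabilityMeasure m₂]
    [IsProbabilityMeasure m₃]
    {f₀ : α → α → ℝ} {f₁ : β → β → ℝ} {f₂ : γ → γ → ℝ} {f₃ : δ → δ → ℝ}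
    (hf₀ : Measurable (Function.uncurry f₀)) (hf₁ : Measurable (Function.uncurry f₁))
    (hf₂ : Measurable (Function.uncurry f₂)) (hf₃ : Measurable (Function.uncurry f₃))
    {μ₁ : Measure (α × β)} {μ₂ : Measure (α × γ)} {μ₃ : Measure (α × δ)}
    (h₁ : μ₁ ∈ Cpl m₀ m₁) (h₂ : μ₂ ∈ Cpl m₀ m₂) (h₃ : μ₃ ∈ Cpl m₀ m₃) :
    DD2 f₁ f₂ m₁ m₂ ^ 2 + DD2 f₁ f₃ m₁ m₃ ^ 2 + DD2 f₂ f₃ m₂ m₃ ^ 2 ≤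
      3 * (distortion2 f₀ f₁ μ₁ ^ 2 + distortion2 f₀ f₂ μ₂ ^ 2 + distortion2 f₀ f₃ μ₃ ^ 2) := by
  obtain ⟨P, _, rfl, rfl, rfl⟩ := exists_gluing h₁ h₂ h₃
  have e₁ : P.map (fun z => z.2.1) = m₁ := by
    rw [← h₁.2, Measure.map_map (by fun_prop) (by fun_prop)]; rfl
  have e₂ : P.map (fun z => z.2.2.1) = m₂ := by
    rw [← h₂.2, Measure.map_map (by fun_prop) (by fun_prop)]; rfl
  have e₃ : P.map (fun z => z.2.2.2) = m₃ := by
    rw [← h₃.2, Measure.map_map (by fun_prop) (by fun_prop)]; rfl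
  rw [distortion2_sq_map (by fun_prop) (by fun_prop) hf₀ hf₁,
    distortion2_sq_map (by fun_prop) (by fun_prop) hf₀ hf₂,
    distortion2_sq_map (by fun_prop) (by fun_prop) hf₀ hf₃, ← e₁, ← e₂, ← e₃]
  have g₀ : Measurable fun p : (α × β × γ × δ) × (α × β × γ × δ) => f₀ p.1.1 p.2.1 :=
    hf₀.comp (f := fun p : (α × β × γ × δ) × (α × β × γ × δ) => (p.1.1, p.2.1)) (by fun_prop)
  have g₁ : Measurable fun p : (α × β × γ × δ) × (α × β × γ × δ) => f₁ p.1.2.1 p.2.2.1 :=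
    hf₁.comp (f := fun p : (α × β × γ × δ) × (α × β × γ × δ) => (p.1.2.1, p.2.2.1))
      (by fun_prop)
  have g₂ : Measurable fun p : (α × β × γ × δ) × (α × β × γ × δ) => f₂ p.1.2.2.1 p.2.2.2.1 :=
    hf₂.comp (f := fun p : (α × β × γ × δ) × (α × β × γ × δ) => (p.1.2.2.1, p.2.2.2.1))
      (by fun_prop)
  have g₃ : Measurable fun p : (α × β × γ × δ) × (α × β × γ × δ) => f₃ p.1.2.2.2 p.2.2.2.2 :=
    hf₃.comp (f := fun p : (α × β × γ × δ) × (α × β × γ × δ) => (p.1.2.2.2, p.2.2.2.2))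
      (by fun_prop)
  refine (add_le_add (add_le_add
    (DD2_sq_le_lintegral (P := P) (by fun_prop) (by fun_prop) hf₁ hf₂)
    (DD2_sq_le_lintegral (P := P) (by fun_prop) (by fun_prop) hf₁ hf₃))
    (DD2_sq_le_lintegral (P := P) (by fun_prop) (by fun_prop) hf₂ hf₃)).trans ?_
  rw [← lintegral_add_left (by fun_prop), ← lintegral_add_left (by fun_prop),
    ← lintegral_add_left (by fun_prop), ← lintegral_add_left (by fun_prop),
    ← lintegral_const_mul' _ _ (by simp)]
  refine lintegral_mono fun p => ?_
  simp only [← ENNReal.ofReal_add, sq_nonneg, add_nonneg]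
  rw [← ENNReal.ofReal_ofNat 3, ← ENNReal.ofReal_mul (by norm_num)]
  refine ENNReal.ofReal_le_ofReal ?_
  nlinarith [sq_nonneg (3 * f₀ p.1.1 p.2.1 - f₁ p.1.2.1 p.2.2.1 - f₂ p.1.2.2.1 p.2.2.2.1
    - f₃ p.1.2.2.2 p.2.2.2.2)]

theorem exists_mem_Cpl_distortion2_le {f₀ : α → α → ℝ} {f₁ : β → β → ℝ} {m₀ : Measure α}
    {m₁ : Measure β} (h : DD2 f₀ f₁ m₀ m₁ ≠ ⊤) {ε : ℝ} (hε : 0 < ε) :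
    ∃ μ ∈ Cpl m₀ m₁,
      distortion2 f₀ f₁ μ ≤ ENNReal.ofReal ((DD2 f₀ f₁ m₀ m₁).toReal + ε) := by
  have hlt : DD2 f₀ f₁ m₀ m₁ < ENNReal.ofReal ((DD2 f₀ f₁ m₀ m₁).toReal + ε) := by
    rw [ENNReal.lt_ofReal_iff_toReal_lt h]
    linarith
  obtain ⟨μ, hlt'⟩ := iInf_lt_iff.1 hlt
  obtain ⟨hμ, hlt'⟩ := iInf_lt_iff.1 hlt'
  exact ⟨μ, hμ, hlt'.le⟩

end

theorem measurable_uncurry_dist {X : Type*} [MetricSpace X] [TopologicalSpace.SeparableSpace X]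
    [MeasurableSpace X] [BorelSpace X] : Measurable (Function.uncurry (dist : X → X → ℝ)) := by
  have := UniformSpace.secondCountable_of_separable X
  exact measurable_dist

theorem standardBorelSpace_of_complete_separable {X : Type*} [MetricSpace X] [CompleteSpace X]
    [TopologicalSpace.SeparableSpace X] [MeasurableSpace X] [BorelSpace X] :
    StandardBorelSpace X := by
  have := UniformSpace.secondCountable_of_separable X
  infer_instance

/-- **Quadruple comparison / nonnegative curvature.** For every
quadruple of metric measure spaces of finite `L²`-size:
`∑_{i=1}^3 DD(X₀,X_i)² ≥ (1/3) ∑_{1≤i<j≤3} DD(X_i,X_j)²`. -/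
theorem DD2_quadruple_comparison
    {X₀ X₁ X₂ X₃ : Type*}
    [MetricSpace X₀] [CompleteSpace X₀] [TopologicalSpace.SeparableSpace X₀]
    [MeasurableSpace X₀] [BorelSpace X₀]
    [MetricSpace X₁] [CompleteSpace X₁] [TopologicalSpace.SeparableSpace X₁]
    [MeasurableSpace X₁] [BorelSpace X₁]
    [MetricSpace X₂] [CompleteSpace X₂] [TopologicalSpace.SeparableSpace X₂]
    [MeasurableSpace X₂] [BorelSpace X₂]
    [MetricSpace X₃] [CompleteSpace X₃] [TopologicalSpace.SeparableSpace X₃]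
    [MeasurableSpace X₃] [BorelSpace X₃]
    (m₀ : Measure X₀) (m₁ : Measure X₁) (m₂ : Measure X₂) (m₃ : Measure X₃)
    [IsProbabilityMeasure m₀] [IsProbabilityMeasure m₁]
    [IsProbabilityMeasure m₂] [IsProbabilityMeasure m₃]
    (hsize₀ : (∫⁻ x, ∫⁻ y, ENNReal.ofReal (dist x y ^ 2) ∂m₀ ∂m₀) ≠ ⊤)
    (hsize₁ : (∫⁻ x, ∫⁻ y, ENNReal.ofReal (dist x y ^ 2) ∂m₁ ∂m₁) ≠ ⊤)
    (hsize₂ : (∫⁻ x, ∫⁻ y, ENNReal.ofReal (dist x y ^ 2) ∂m₂ ∂m₂) ≠ ⊤)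
    (hsize₃ : (∫⁻ x, ∫⁻ y, ENNReal.ofReal (dist x y ^ 2) ∂m₃ ∂m₃) ≠ ⊤) :
    (DD2 dist dist m₀ m₁).toReal ^ 2 + (DD2 dist dist m₀ m₂).toReal ^ 2
        + (DD2 dist dist m₀ m₃).toReal ^ 2 ≥
      (1 / 3 : ℝ) *
        ((DD2 dist dist m₁ m₂).toReal ^ 2 + (DD2 dist dist m₁ m₃).toReal ^ 2
          + (DD2 dist dist m₂ m₃).toReal ^ 2) := by
  have := standardBorelSpace_of_complete_separable (X := X₁)
  have := standardBorelSpace_of_complete_separable (X := X₂)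
  have := standardBorelSpace_of_complete_separable (X := X₃)
  have d₀ := measurable_uncurry_dist (X := X₀)
  have d₁ := measurable_uncurry_dist (X := X₁)
  have d₂ := measurable_uncurry_dist (X := X₂)
  have d₃ := measurable_uncurry_dist (X := X₃)
  have t₁ := DD2_ne_top d₀ d₁ hsize₀ hsize₁
  have t₂ := DD2_ne_top d₀ d₂ hsize₀ hsize₂
  have t₃ := DD2_ne_top d₀ d₃ hsize₀ hsize₃
  have t₁₂ := DD2_ne_top d₁ d₂ hsize₁ hsize₂
  have t₁₃ := DD2_ne_top d₁ d₃ hsize₁ hsize₃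
  have t₂₃ := DD2_ne_top d₂ d₃ hsize₂ hsize₃
  set a₁ := (DD2 dist dist m₀ m₁).toReal with ha₁
  set a₂ := (DD2 dist dist m₀ m₂).toReal with ha₂
  set a₃ := (DD2 dist dist m₀ m₃).toReal with ha₃
  have p₁ : 0 ≤ a₁ := ENNReal.toReal_nonneg
  have p₂ : 0 ≤ a₂ := ENNReal.toReal_nonneg
  have p₃ : 0 ≤ a₃ := ENNReal.toReal_nonneg
  have approx : ∀ ε : ℝ, 0 < ε →
      (DD2 dist dist m₁ m₂).toReal ^ 2 + (DD2 dist dist m₁ m₃).toReal ^ 2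
        + (DD2 dist dist m₂ m₃).toReal ^ 2 ≤
      3 * ((a₁ + ε) ^ 2 + (a₂ + ε) ^ 2 + (a₃ + ε) ^ 2) := by
    intro ε hε
    obtain ⟨μ₁, h₁, l₁⟩ := exists_mem_Cpl_distortion2_le t₁ hε
    obtain ⟨μ₂, h₂, l₂⟩ := exists_mem_Cpl_distortion2_le t₂ hε
    obtain ⟨μ₃, h₃, l₃⟩ := exists_mem_Cpl_distortion2_le t₃ hε
    rw [← ENNReal.ofReal_le_ofReal_iff (by positivity), ENNReal.ofReal_mul (by norm_num)]
    simp only [ENNReal.ofReal_add, sq_nonneg, add_nonneg]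
    rw [ENNReal.ofReal_pow (by positivity), ENNReal.ofReal_pow (by positivity),
      ENNReal.ofReal_pow (by positivity), ENNReal.ofReal_pow (by positivity),
      ENNReal.ofReal_pow (by positivity), ENNReal.ofReal_pow (by positivity),
      ENNReal.ofReal_toReal t₁₂, ENNReal.ofReal_toReal t₁₃, ENNReal.ofReal_toReal t₂₃,
      ENNReal.ofReal_ofNat]
    refine (sum_DD2_sq_le_distortion2 d₀ d₁ d₂ d₃ h₁ h₂ h₃).trans ?_
    gcongr
  have lim : Filter.Tendsto
      (fun ε : ℝ => 3 * ((a₁ + ε) ^ 2 + (a₂ + ε) ^ 2 + (a₃ + ε) ^ 2)) (nhdsWithin 0 (Set.Ioi 0))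
      (nhds (3 * ((a₁ + 0) ^ 2 + (a₂ + 0) ^ 2 + (a₃ + 0) ^ 2))) :=
    (Continuous.tendsto (by fun_prop) 0).mono_left nhdsWithin_le_nhds
  have := ge_of_tendsto lim (Filter.eventually_of_mem self_mem_nhdsWithin approx)
  simp only [add_zero] at this
  linarith
end

section
/- Discrete continuum: let (X,m) and (X',m') be Polish spaces with atomless Borel probability measures (i.e. m({x}) = 0 for every x ∈ X and likewise for m'), and equip each with the discrete metric d(x,y) = 0 if x = y and d(x,y) = 1 otherwise (and similarly d'). Then DD((X,d,m),(X',d',m')) = 0; in fact, for every coupling μ̄ ∈ Cpl(m,m') one has ∫∫ |d(x,y) − d'(x',y')|² dμ̄(x,x') dμ̄(y,y') = 0, so that (X,d,m) and (X',d',m') are homomorphic as gauged measure spaces. -/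
open MeasureTheory ENNReal

/-- The discrete metric: `0` on the diagonal, `1` off the diagonal. -/
noncomputable def discreteDist {α : Type*} (x y : α) : ℝ :=
  letI := Classical.decEq α
  if x = y then 0 else 1

theorem discreteDist_of_ne {α : Type*} {x y : α} (h : x ≠ y) : discreteDist x y = 1 :=
  if_neg h

theorem ae_ne_of_map_singleton_eq_zero {α β : Type*} [MeasurableSpace α] [MeasurableSpace β]
    [MeasurableSingletonClass β] {μ : Measure α} {f : α → β} (hf : Measurable f) {y : β}
    (h : μ.map f {y} = 0) : ∀ᵐ w ∂μ, y ≠ f w := by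
  rw [Measure.map_apply hf (measurableSet_singleton y)] at h
  filter_upwards [measure_eq_zero_iff_ae_notMem.1 h] with w hw heq
  exact hw heq.symm

theorem lintegral_discreteDist_sub_sq_eq_zero {α β : Type*}
    [MeasurableSpace α] [MeasurableSpace β]
    [MeasurableSingletonClass α] [MeasurableSingletonClass β]
    {m : Measure α} {m' : Measure β} (hm : ∀ x, m {x} = 0) (hm' : ∀ x', m' {x'} = 0)
    {μ : Measure (α × β)} (hμ : μ ∈ Cpl m m') :
    ∫⁻ z, ∫⁻ w, ENNReal.ofReal ((discreteDist z.1 w.1 - discreteDist z.2 w.2) ^ 2) ∂μ ∂μ = 0 := by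
  refine lintegral_eq_zero_of_ae_eq_zero (Filter.Eventually.of_forall fun z ↦
    lintegral_eq_zero_of_ae_eq_zero ?_)
  filter_upwards [
    ae_ne_of_map_singleton_eq_zero measurable_fst ((congrArg (· {z.1}) hμ.1).trans (hm z.1)),
    ae_ne_of_map_singleton_eq_zero measurable_snd ((congrArg (· {z.2}) hμ.2).trans (hm' z.2))]
    with w h₁ h₂
  simp [discreteDist_of_ne h₁, discreteDist_of_ne h₂]

theorem prod_mem_Cpl {α β : Type*} [MeasurableSpace α] [MeasurableSpace β]
    (m : Measure α) (m' : Measure β) [IsProbabilityMeasure m] [IsProbabilityMeasure m'] :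
    m.prod m' ∈ Cpl m m' :=
  ⟨by simp [Measure.map_fst_prod], by simp [Measure.map_snd_prod]⟩

/-- **Discrete continuum.** Let `(X,m)` and `(X',m')` be Polish
spaces with atomless Borel probability measures, each equipped with the discrete
metric. Then for every coupling `μ` of `m` and `m'` the squared distortion
`∬ |d(x,y) − d'(x',y')|² dμ dμ` vanishes; in particular
`DD((X,d,m),(X',d',m')) = 0`, i.e. the two spaces are homomorphic as gauged
measure spaces. -/
theorem discrete_continuum_homomorphic
    {X X' : Type*}
    [MetricSpace X] [CompleteSpace X] [TopologicalSpace.SeparableSpace X]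
    [MeasurableSpace X] [BorelSpace X]
    [MetricSpace X'] [CompleteSpace X'] [TopologicalSpace.SeparableSpace X']
    [MeasurableSpace X'] [BorelSpace X']
    (m : Measure X) (m' : Measure X')
    [IsProbabilityMeasure m] [IsProbabilityMeasure m']
    (hm : ∀ x : X, m {x} = 0) (hm' : ∀ x' : X', m' {x'} = 0) :
    (∀ μ ∈ Cpl m m',
      (∫⁻ z, ∫⁻ w,
          ENNReal.ofReal ((discreteDist z.1 w.1 - discreteDist z.2 w.2) ^ 2)
            ∂μ ∂μ) = 0) ∧
    DD2 discreteDist discreteDist m m' = 0 := by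
  refine ⟨fun μ hμ ↦ lintegral_discreteDist_sub_sq_eq_zero hm hm' hμ, ?_⟩
  refine le_antisymm (iInf₂_le_of_le (m.prod m') (prod_mem_Cpl m m') ?_) zero_le
  rw [distortion2, lintegral_discreteDist_sub_sq_eq_zero hm hm' (prod_mem_Cpl m m')]
  simp
end
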